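/- For p > 1, d ∈ (-1,1), ν > -1+|d|, with λ = λ(d,ν) = (1-d²)^{1/(p-1)}/((1+ν)²-d²)^{1/(p-1)}, the energy of the generalized soliton satisfies E(κ₁*(d,ν,·), κ₂*(d,ν,·)) = E(κ₀,0) · ( ((p+1)/(p-1)) λ² - (2/(p-1)) λ^{p+1} + (2/(p-1)) (ν²/(1-d²)) λ^{p+1} ). -/

import Mathlib

noncomputable def kappa0 (p : ℝ) : ℝ := (2 * (p + 1) / (p - 1) ^ 2) ^ (1 / (p - 1))

noncomputable def kapStar1 (p d ν y : ℝ) : ℝ :=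
  kappa0 p * (1 - d ^ 2) ^ (1 / (p - 1)) / (1 + d * y + ν) ^ (2 / (p - 1))

noncomputable def kapStar2 (p d ν y : ℝ) : ℝ :=
  -(2 * kappa0 p * ν / (p - 1)) * (1 - d ^ 2) ^ (1 / (p - 1))
    / (1 + d * y + ν) ^ ((p + 1) / (p - 1))

noncomputable def lam (p d ν : ℝ) : ℝ :=
  (1 - d ^ 2) ^ (1 / (p - 1)) / ((1 + ν) ^ 2 - d ^ 2) ^ (1 / (p - 1))

noncomputable def En (p : ℝ) (V₁ V₂ : ℝ → ℝ) : ℝ :=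
  ∫ y in (-1 : ℝ)..1,
    ((1 / 2) * V₂ y ^ 2 + (1 / 2) * (deriv V₁ y) ^ 2 * (1 - y ^ 2)
        + ((p + 1) / (p - 1) ^ 2) * V₁ y ^ 2 - (1 / (p + 1)) * |V₁ y| ^ (p + 1))
      * (1 - y ^ 2) ^ (2 / (p - 1))

theorem aux_pos (d m y : ℝ) (hm : |d| < m) (hy : y ∈ Set.Icc (-1 : ℝ) 1) : 0 < m + d * y := by
  have h1 : |d * y| ≤ |d| := by
    rw [abs_mul]
    exact mul_le_of_le_one_right (abs_nonneg _) (abs_le.2 hy)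
  have := neg_abs_le (d * y)
  linarith

theorem aux_J (α d m : ℝ) (hα : 0 < α) (hm : |d| < m) :
    ∫ y in (-1 : ℝ)..1, (1 - y ^ 2) ^ α
      = (m ^ 2 - d ^ 2) ^ (α + 1) *
        ∫ y in (-1 : ℝ)..1, (m + d * y) ^ (-2 * α - 2) * (1 - y ^ 2) ^ α := by
  have hD : 0 < m ^ 2 - d ^ 2 := by
    have := sq_lt_sq' (by linarith [abs_nonneg d]) hm
    rw [sq_abs] at this
    linarith
  have h1 : m + d ≠ 0 := by
    have := aux_pos d m 1 hm (by norm_num)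
    rw [mul_one] at this; exact this.ne'
  have h2 : m - d ≠ 0 := by
    have := aux_pos d m (-1) hm (by norm_num)
    have h : m - d = m + d * (-1) := by ring
    rw [h]; exact this.ne'
  have hu : Set.uIcc (-1 : ℝ) 1 = Set.Icc (-1) 1 := Set.uIcc_of_le (by norm_num)
  have key := intervalIntegral.integral_comp_mul_deriv (a := (-1 : ℝ)) (b := 1)
    (f := fun y => (m * y + d) / (m + d * y))
    (f' := fun y => (m ^ 2 - d ^ 2) / (m + d * y) ^ 2)
    (g := fun z => (1 - z ^ 2) ^ α) ?_ ?_ ?_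
  · have e1 : (m * (1 : ℝ) + d) / (m + d * 1) = 1 := by
      simp only [mul_one]; exact div_self h1
    have e2 : (m * (-1 : ℝ) + d) / (m + d * (-1)) = -1 := by
      have h3 : m + d * (-1) ≠ 0 := by
        intro h; apply h2; linarith
      rw [div_eq_iff h3]; ring
    simp only [e1, e2] at key
    rw [← key, ← intervalIntegral.integral_const_mul]
    apply intervalIntegral.integral_congr
    intro y hy
    rw [hu] at hy
    have hp := aux_pos d m y hm hy
    have hw : 0 ≤ 1 - y ^ 2 := by nlinarith [hy.1, hy.2]
    simp only [Function.comp]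
    have e3 : 1 - ((m * y + d) / (m + d * y)) ^ 2
        = (m ^ 2 - d ^ 2) * (1 - y ^ 2) * ((m + d * y) ^ 2)⁻¹ := by
      have hne := hp.ne'
      rw [div_pow, eq_mul_inv_iff_mul_eq₀ (by positivity), sub_mul,
        div_mul_cancel₀ _ (by positivity)]
      ring
    rw [e3, Real.mul_rpow (by positivity) (by positivity), Real.mul_rpow hD.le hw,
      Real.inv_rpow (by positivity), ← Real.rpow_natCast (m + d * y), ← Real.rpow_mul hp.le,
      ← Real.rpow_neg hp.le, div_eq_mul_inv, ← Real.rpow_neg hp.le, Real.rpow_add_one hD.ne']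
    have e4 : (m + d * y) ^ (-2 * α - 2)
        = (m + d * y) ^ (-(((2 : ℕ) : ℝ) * α)) * (m + d * y) ^ (-((2 : ℕ) : ℝ)) := by
      rw [← Real.rpow_add hp]; congr 1; push_cast; ring
    rw [e4]; ring
  · intro y hy
    rw [hu] at hy
    have hp := aux_pos d m y hm hy
    have a1 : HasDerivAt (fun y : ℝ => m * y + d) m y := by
      simpa using ((hasDerivAt_id y).const_mul m).add_const d
    have a2 : HasDerivAt (fun y : ℝ => m + d * y) d y := by
      simpa using ((hasDerivAt_id y).const_mul d).const_add m
    refine (a1.div a2 hp.ne').congr_deriv ?_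
    congr 1; ring
  · rw [hu]
    apply ContinuousOn.div (by fun_prop) (by fun_prop)
    intro y hy
    exact (pow_pos (aux_pos d m y hm hy) 2).ne'
  · exact Continuous.rpow_const (by fun_prop) (fun _ => Or.inr hα.le)

theorem aux_cont (α d m s : ℝ) (hα : 0 < α) (hm : |d| < m) :
    ContinuousOn (fun y : ℝ => (m + d * y) ^ s * (1 - y ^ 2) ^ α) (Set.uIcc (-1 : ℝ) 1) := by
  rw [Set.uIcc_of_le (by norm_num)]
  apply ContinuousOn.mul
  · apply ContinuousOn.rpow_const (by fun_prop)
    intro y hy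
    exact Or.inl (aux_pos d m y hm hy).ne'
  · exact ContinuousOn.rpow_const (by fun_prop) (fun _ _ => Or.inr hα.le)

theorem aux_F (α d m : ℝ) (hα : 0 < α) (hm : |d| < m) :
    ∫ y in (-1 : ℝ)..1, (α * d ^ 2 * (1 - y ^ 2) + (α + 1) * ((m + d * y) ^ 2 - (m ^ 2 - d ^ 2)))
      * ((m + d * y) ^ (-2 * α - 2) * (1 - y ^ 2) ^ α) = 0 := by
  have hu : Set.uIcc (-1 : ℝ) 1 = Set.Icc (-1) 1 := Set.uIcc_of_le (by norm_num)
  rw [intervalIntegral.integral_eq_sub_of_hasDerivAt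
    (f := fun y => -d * ((1 - y ^ 2) ^ (α + 1) * (m + d * y) ^ (-2 * α - 1)))]
  · have : α + 1 ≠ 0 := by positivity
    norm_num [Real.zero_rpow this]
  · intro y hy
    rw [hu] at hy
    have hp := aux_pos d m y hm hy
    have hw : 0 ≤ 1 - y ^ 2 := by nlinarith [hy.1, hy.2]
    have a1 : HasDerivAt (fun y : ℝ => 1 - y ^ 2) (-(2 * y)) y := by
      simpa using ((hasDerivAt_id y).pow 2).const_sub 1
    have a2 : HasDerivAt (fun y : ℝ => m + d * y) d y := by
      simpa using ((hasDerivAt_id y).const_mul d).const_add m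
    have b1 := a1.rpow_const (p := α + 1) (Or.inr (by linarith))
    have b2 := a2.rpow_const (p := -2 * α - 1) (Or.inl hp.ne')
    refine ((b1.mul b2).const_mul (-d)).congr_deriv ?_
    have e1 : (1 - y ^ 2) ^ (α + 1) = (1 - y ^ 2) ^ α * (1 - y ^ 2) :=
      Real.rpow_add_one' hw (by positivity)
    have e2 : (m + d * y) ^ (-2 * α - 1) = (m + d * y) ^ (-2 * α - 2) * (m + d * y) := by
      rw [← Real.rpow_add_one hp.ne']; congr 1; ring
    have e3 : -2 * α - 1 - 1 = -2 * α - 2 := by ring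
    have e4 : α + 1 - 1 = α := by ring
    rw [e3, e4, e1, e2]; ring
  · apply ContinuousOn.intervalIntegrable
    exact ContinuousOn.mul (by fun_prop) (aux_cont α d m _ hα hm)

theorem energy_generalized_soliton (p : ℝ) (hp : 1 < p) (d ν : ℝ)
    (hd : d ∈ Set.Ioo (-1 : ℝ) 1) (hν : -1 + |d| < ν) :
    En p (kapStar1 p d ν) (kapStar2 p d ν)
      = En p (fun _ => kappa0 p) (fun _ => 0)
        * (((p + 1) / (p - 1)) * lam p d ν ^ 2 - (2 / (p - 1)) * lam p d ν ^ (p + 1)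
            + (2 / (p - 1)) * (ν ^ 2 / (1 - d ^ 2)) * lam p d ν ^ (p + 1)) := by
  have hp1 : 0 < p - 1 := by linarith
  have hm : |d| < 1 + ν := by linarith
  have hd2 : 0 < 1 - d ^ 2 := by nlinarith [hd.1, hd.2]
  have hD : 0 < (1 + ν) ^ 2 - d ^ 2 := by
    have := sq_lt_sq' (by linarith [abs_nonneg d]) hm
    rw [sq_abs] at this
    linarith
  have hu : Set.uIcc (-1 : ℝ) 1 = Set.Icc (-1) 1 := Set.uIcc_of_le (by norm_num)
  obtain ⟨α, hαdef⟩ : ∃ α, α = 2 / (p - 1) := ⟨_, rfl⟩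
  have hα : 0 < α := by rw [hαdef]; positivity
  have hpα : p = 1 + 2 / α := by rw [hαdef]; field_simp; ring
  have r1 : 1 / (p - 1) = α / 2 := by rw [hαdef]; ring
  have r2 : (p + 1) / (p - 1) = α + 1 := by rw [hαdef]; field_simp; ring
  have r3 : (p + 1) / (p - 1) ^ 2 = α * (α + 1) / 2 := by rw [hαdef]; field_simp; ring
  have r4 : α * (p + 1) = 2 * α + 2 := by rw [hαdef]; field_simp; ring
  have hk : 0 < kappa0 p := by unfold kappa0; positivity
  have hkp : kappa0 p ^ (p + 1) / (p + 1) = kappa0 p ^ 2 * (α ^ 2 / 2) := by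
    have h1 : kappa0 p ^ (p - 1) = 2 * (p + 1) / (p - 1) ^ 2 := by
      unfold kappa0
      rw [← Real.rpow_mul (by positivity), one_div_mul_cancel hp1.ne', Real.rpow_one]
    have h2 : kappa0 p ^ (p + 1) = kappa0 p ^ 2 * kappa0 p ^ (p - 1) := by
      rw [← Real.rpow_natCast, ← Real.rpow_add hk]; congr 1; push_cast; ring
    rw [h2, h1, hαdef]; field_simp
  obtain ⟨k, hkdef⟩ : ∃ k, k = kappa0 p := ⟨_, rfl⟩
  obtain ⟨A, hA⟩ : ∃ A, A = (1 - d ^ 2) ^ (α / 2) := ⟨_, rfl⟩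
  obtain ⟨B, hB⟩ : ∃ B, B = ((1 + ν) ^ 2 - d ^ 2) ^ (α / 2) := ⟨_, rfl⟩
  have hA0 : 0 < A := by rw [hA]; positivity
  have hB0 : 0 < B := by rw [hB]; positivity
  have powp : ∀ x : ℝ, 0 < x → (x ^ (α / 2)) ^ (p + 1) = (x ^ (α / 2)) ^ 2 * x := by
    intro x hx
    rw [← Real.rpow_mul hx.le, ← Real.rpow_natCast, ← Real.rpow_mul hx.le,
      ← Real.rpow_add_one hx.ne']
    congr 1; push_cast; linarith
  have hAp : A ^ (p + 1) = A ^ 2 * (1 - d ^ 2) := by rw [hA]; exact powp _ hd2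
  have hBp : B ^ (p + 1) = B ^ 2 * ((1 + ν) ^ 2 - d ^ 2) := by rw [hB]; exact powp _ hD
  have hlam : lam p d ν = A / B := by unfold lam; rw [r1, hA, hB]
  have hE0 : En p (fun _ => kappa0 p) (fun _ => 0)
      = k ^ 2 * (α / 2) * ∫ y in (-1 : ℝ)..1, (1 - y ^ 2) ^ α := by
    unfold En
    rw [← intervalIntegral.integral_const_mul]
    apply intervalIntegral.integral_congr
    intro y _
    simp only [deriv_const, r3, ← hαdef, ← hkdef] at hkp ⊢
    have : 1 / (p + 1) * k ^ (p + 1) = k ^ 2 * (α ^ 2 / 2) := by rw [← hkp]; ring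
    have hk2 : 0 < k := by rw [hkdef]; exact hk
    rw [abs_of_pos hk2, this]; ring
  have hE1 : En p (kapStar1 p d ν) (kapStar2 p d ν)
      = k ^ 2 * A ^ 2 * (α ^ 2 / 2 * (ν ^ 2 - (1 - d ^ 2))
          + α * (α + 1) / 2 * ((1 + ν) ^ 2 - d ^ 2))
        * ∫ y in (-1 : ℝ)..1, (1 + ν + d * y) ^ (-2 * α - 2) * (1 - y ^ 2) ^ α := by
    have hF := aux_F α d (1 + ν) hα hm
    have hc := aux_cont α d (1 + ν) (-2 * α - 2) hα hm
    have hz : k ^ 2 * A ^ 2 * (α / 2) * _ = _ := congrArg (k ^ 2 * A ^ 2 * (α / 2) * ·) hF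
    rw [mul_zero] at hz
    refine Eq.trans ?_ ((congrArg (_ + ·) hz).trans (add_zero _))
    beta_reduce
    rw [← intervalIntegral.integral_const_mul,
      ← intervalIntegral.integral_const_mul, ← intervalIntegral.integral_add]
    · unfold En
      apply intervalIntegral.integral_congr
      intro y hy
      rw [hu] at hy
      have hp := aux_pos d (1 + ν) y hm hy
      have hw : 0 ≤ 1 - y ^ 2 := by nlinarith [hy.1, hy.2]
      have f1 : kapStar1 p d ν = fun y => k * A / (1 + ν + d * y) ^ α := by
        funext z
        unfold kapStar1
        rw [r1, ← hαdef, ← hA, ← hkdef]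
        congr 2; ring
      have f2 : kapStar2 p d ν y = -(α * ν * k * A) * (1 + ν + d * y) ^ (-α - 1) := by
        unfold kapStar2
        rw [r1, r2, ← hA, ← hkdef, hαdef, ← hαdef,
          show 1 + d * y + ν = 1 + ν + d * y by ring,
          show -α - 1 = -(α + 1) by ring, Real.rpow_neg hp.le, hαdef]
        ring
      have a2 : HasDerivAt (fun y : ℝ => 1 + ν + d * y) d y := by
        simpa using ((hasDerivAt_id y).const_mul d).const_add (1 + ν)
      have f3 : deriv (kapStar1 p d ν) y = -(α * d * k * A) * (1 + ν + d * y) ^ (-α - 1) := by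
        have b := (a2.rpow_const (p := -α) (Or.inl hp.ne')).const_mul (k * A)
        have hev : kapStar1 p d ν =ᶠ[nhds y] fun y => k * A * (1 + ν + d * y) ^ (-α) := by
          filter_upwards [a2.continuousAt.eventually (lt_mem_nhds hp)] with z hz
          rw [f1, Real.rpow_neg hz.le]; rfl
        rw [hev.deriv_eq, b.deriv]; ring
      obtain ⟨X, hX⟩ : ∃ X, X = (1 + ν + d * y) ^ (-α - 1) := ⟨_, rfl⟩
      have g1 : (1 + ν + d * y) ^ (-2 * α - 2) = X ^ 2 := by
        rw [hX, ← Real.rpow_natCast, ← Real.rpow_mul hp.le]; congr 1; push_cast; ring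
      have g2 : kapStar1 p d ν y = k * A * (X * (1 + ν + d * y)) := by
        rw [f1, hX, ← Real.rpow_add_one hp.ne', show -α - 1 + 1 = -α by ring,
          Real.rpow_neg hp.le]; rfl
      have hk' : 0 < k := by rw [hkdef]; exact hk
      have g3 : 1 / (p + 1) * |kapStar1 p d ν y| ^ (p + 1)
          = k ^ 2 * (α ^ 2 / 2) * (A ^ 2 * (1 - d ^ 2)) * X ^ 2 := by
        have hX0 : 0 < X := by rw [hX]; positivity
        have g4 : (X * (1 + ν + d * y)) ^ (p + 1) = X ^ 2 := by
          rw [hX, ← Real.rpow_add_one hp.ne', ← Real.rpow_mul hp.le, ← Real.rpow_natCast,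
            ← Real.rpow_mul hp.le]
          congr 1; push_cast; linarith
        rw [g2, abs_of_pos (by positivity), Real.mul_rpow (by positivity) (by positivity),
          Real.mul_rpow hk'.le hA0.le, g4, hAp]
        rw [← hkdef] at hkp
        rw [← hkp]; ring
      simp only [g3]
      rw [f2, f3, g2, g1, r3, ← hX, ← hαdef]
      ring
    · exact (continuousOn_const.mul hc).intervalIntegrable
    · apply ContinuousOn.intervalIntegrable
      exact continuousOn_const.mul (ContinuousOn.mul (by fun_prop) hc)
  rw [hE0, hE1, hlam, aux_J α d (1 + ν) hα hm, Real.div_rpow hA0.le hB0.le, hAp, hBp, r2, ← hαdef]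
  have hBB : ((1 + ν) ^ 2 - d ^ 2) ^ (α + 1) = B ^ 2 * ((1 + ν) ^ 2 - d ^ 2) := by
    rw [hB, Real.rpow_add_one hD.ne', ← Real.rpow_natCast (_ ^ (α / 2)), ← Real.rpow_mul hD.le]
    congr 2; push_cast; ring
  rw [hBB]
  generalize (∫ y in (-1 : ℝ)..1, (1 + ν + d * y) ^ (-2 * α - 2) * (1 - y ^ 2) ^ α) = J
  have hD' := hD.ne'
  have hd2' := hd2.ne'
  generalize (1 + ν) ^ 2 - d ^ 2 = D at *
  generalize 1 - d ^ 2 = q at *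
  field_simp
  ring
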